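/- γ - ln(π) + ln(2) = Σ_{n=1}^∞ 2·N₁(n)/(2n(2n+1)(2n+2)), where γ is the Euler–Mascheroni constant and N₁(n) is the number of ones in the binary expansion of n. In particular all summands on the right are nonnegative. -/

import Mathlib

open Filter Finset

namespace EulerLogSeries

/-- The number of ones in the binary expansion of `n`. -/
def binaryOnes (n : ℕ) : ℕ := (Nat.digits 2 n).count 1

lemma binaryOnes_zero : binaryOnes 0 = 0 := by simp [binaryOnes]

lemma binaryOnes_two_mul (n : ℕ) : binaryOnes (2 * n) = binaryOnes n := by
  rcases Nat.eq_zero_or_pos n with rfl | hn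
  · simp
  · simp [binaryOnes, Nat.digits_base_mul one_lt_two hn]

lemma binaryOnes_two_mul_add_one (n : ℕ) : binaryOnes (2 * n + 1) = binaryOnes n + 1 := by
  have h := Nat.digits_add_two_add_one 0 (2 * n)
  have h1 : (2 * n + 1) / 2 = n := by omega
  have h2 : (2 * n + 1) % 2 = 1 := by omega
  simp only [zero_add, h1, h2] at h
  rw [binaryOnes, h, List.count_cons_self, binaryOnes]

lemma binaryOnes_sq_le (n : ℕ) : binaryOnes n ^ 2 ≤ 2 * n := by
  induction n using Nat.strong_induction_on with
  | _ n ih =>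
    rcases Nat.even_or_odd' n with ⟨k, rfl | rfl⟩
    · rcases Nat.eq_zero_or_pos k with rfl | hk
      · simp [binaryOnes_zero]
      · rw [binaryOnes_two_mul]
        have := ih k (by omega)
        omega
    · rw [binaryOnes_two_mul_add_one]
      have := ih k (by omega)
      zify at this ⊢
      nlinarith [sq_nonneg ((binaryOnes k : ℤ) - 1)]

/-- Twice the error of the trapezoidal rule for `∫ 1/x` on `[n, n + 1]`. -/
noncomputable def trapezoidError (n : ℕ) : ℝ :=
  1 / (n : ℝ) + 1 / ((n : ℝ) + 1) - 2 * Real.log (((n : ℝ) + 1) / n)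

lemma abs_trapezoidError_le {n : ℕ} (hn : 0 < n) : |trapezoidError n| ≤ 1 / (n : ℝ) ^ 2 := by
  have hx : (0 : ℝ) < n := by exact_mod_cast hn
  have hupper := Real.log_le_sub_one_of_pos (show 0 < ((n : ℝ) + 1) / n by positivity)
  have hlower := Real.one_sub_inv_le_log_of_pos (show 0 < ((n : ℝ) + 1) / n by positivity)
  have e1 : ((n : ℝ) + 1) / n - 1 = 1 / n := by field_simp; ring
  have e2 : 1 - (((n : ℝ) + 1) / n)⁻¹ = 1 / ((n : ℝ) + 1) := by field_simp; ring
  have e3 : 1 / (n : ℝ) - 1 / ((n : ℝ) + 1) ≤ 1 / (n : ℝ) ^ 2 := by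
    rw [div_sub_div _ _ hx.ne' (by positivity), div_le_div_iff₀ (by positivity) (by positivity)]
    nlinarith
  rw [e1] at hupper
  rw [e2] at hlower
  rw [trapezoidError, abs_le]
  constructor <;> linarith

lemma trapezoidError_sub {n : ℕ} (hn : 0 < n) :
    trapezoidError n - trapezoidError (2 * n) - trapezoidError (2 * n + 1) =
      2 / (2 * (n : ℝ) * (2 * n + 1) * (2 * n + 2)) := by
  have hx : (0 : ℝ) < n := by exact_mod_cast hn
  have hlog : Real.log (((n : ℝ) + 1) / n) =
      Real.log ((2 * (n : ℝ) + 1) / (2 * n)) + Real.log ((2 * (n : ℝ) + 1 + 1) / (2 * n + 1)) := by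
    rw [← Real.log_mul (by positivity) (by positivity)]
    congr 1
    field_simp
    ring
  simp only [trapezoidError]
  push_cast
  rw [hlog]
  field_simp
  ring

lemma summable_binaryOnes_mul_trapezoidError :
    Summable fun n ↦ (binaryOnes n : ℝ) * trapezoidError n := by
  have hs : Summable fun n : ℕ ↦ Real.sqrt 2 * (n : ℝ) ^ (-(3 / 2) : ℝ) :=
    (Real.summable_nat_rpow.2 (by norm_num)).mul_left _
  refine Summable.of_norm_bounded hs fun n ↦ ?_
  rcases Nat.eq_zero_or_pos n with rfl | hn
  · simp only [binaryOnes_zero, Nat.cast_zero, zero_mul, norm_zero]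
    positivity
  have hx : (0 : ℝ) < n := by exact_mod_cast hn
  have hb : (binaryOnes n : ℝ) ≤ Real.sqrt 2 * (n : ℝ) ^ (1 / 2 : ℝ) := by
    rw [← Real.sqrt_eq_rpow, ← Real.sqrt_mul (by norm_num)]
    exact Real.le_sqrt_of_sq_le (by exact_mod_cast binaryOnes_sq_le n)
  have hp : (n : ℝ) ^ (-(3 / 2) : ℝ) = (n : ℝ) ^ (1 / 2 : ℝ) * (1 / (n : ℝ) ^ 2) := by
    rw [show (-(3 / 2) : ℝ) = 1 / 2 - (2 : ℕ) by norm_num, Real.rpow_sub_natCast hx.ne']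
    ring
  rw [norm_mul, Real.norm_eq_abs, Real.norm_eq_abs, Nat.abs_cast, hp, ← mul_assoc]
  exact mul_le_mul hb (abs_trapezoidError_le hn) (abs_nonneg _) (by positivity)

lemma sum_trapezoidError_odd (N : ℕ) :
    ∑ n ∈ range N, trapezoidError (2 * n + 1) =
      Real.eulerMascheroniSeq (2 * N) - Real.log (Real.Wallis.W N) := by
  induction N with
  | zero => simp [Real.eulerMascheroniSeq, Real.Wallis.W]
  | succ k ih =>
    rw [sum_range_succ, ih, Real.Wallis.W_succ,
      Real.log_mul (Real.Wallis.W_pos k).ne' (by positivity),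
      Real.log_mul (by positivity) (by positivity)]
    simp only [trapezoidError, Real.eulerMascheroniSeq, show 2 * (k + 1) = 2 * k + 1 + 1 by ring,
      harmonic_succ]
    push_cast
    rw [Real.log_div (by positivity) (by positivity), Real.log_div (by positivity) (by positivity),
      Real.log_div (by positivity) (by positivity)]
    ring_nf

lemma hasSum_trapezoidError_odd :
    HasSum (fun n : ℕ ↦ trapezoidError (2 * n + 1))
      (Real.eulerMascheroniConstant - Real.log (Real.pi / 2)) := by
  have hodd : Summable fun n : ℕ ↦
      ‖(binaryOnes (2 * n + 1) : ℝ) * trapezoidError (2 * n + 1)‖ :=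
    summable_binaryOnes_mul_trapezoidError.norm.comp_injective
      (i := fun n ↦ 2 * n + 1) fun a b h ↦ by simpa using h
  have hs : Summable fun n : ℕ ↦ trapezoidError (2 * n + 1) := by
    refine Summable.of_norm_bounded hodd fun n ↦ ?_
    rw [norm_mul, binaryOnes_two_mul_add_one, Real.norm_natCast]
    refine le_mul_of_one_le_left (norm_nonneg _) ?_
    push_cast
    linarith [Nat.cast_nonneg (α := ℝ) (binaryOnes n)]
  rw [hs.hasSum_iff_tendsto_nat]
  simp only [sum_trapezoidError_odd]
  refine (Real.tendsto_eulerMascheroniSeq.comp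
    (tendsto_id.const_mul_atTop' two_pos)).sub ?_
  exact Real.Wallis.tendsto_W_nhds_pi_div_two.log (by positivity)

lemma hasSum_binaryOnes_mul :
    HasSum (fun n : ℕ ↦ (binaryOnes n : ℝ) * (2 / (2 * (n : ℝ) * (2 * n + 1) * (2 * n + 2))))
      (Real.eulerMascheroniConstant - Real.log (Real.pi / 2)) := by
  have hs := summable_binaryOnes_mul_trapezoidError
  have heven := (hs.comp_injective (i := fun n ↦ 2 * n) fun a b h ↦ by simpa using h).hasSum
  have hodd := (hs.comp_injective (i := fun n ↦ 2 * n + 1) fun a b h ↦ by simpa using h).hasSum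
  have htotal := hs.hasSum.unique (heven.even_add_odd hodd)
  have hcombined := ((hs.hasSum.sub heven).sub hodd).add hasSum_trapezoidError_odd
  rw [htotal, add_sub_cancel_left, sub_self, zero_add] at hcombined
  refine hcombined.congr_fun fun n ↦ ?_
  rcases Nat.eq_zero_or_pos n with rfl | hn
  · simp [binaryOnes_zero, show binaryOnes 1 = 1 by simp [binaryOnes]]
  · rw [← trapezoidError_sub hn]
    simp only [Function.comp_apply, binaryOnes_two_mul, binaryOnes_two_mul_add_one]
    push_cast
    ring

end EulerLogSeries

open EulerLogSeries

/-- `γ - ln π + ln 2 = Σ_{n≥1} 2·N₁(n)/(2n(2n+1)(2n+2))`, with all summands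
nonnegative. -/
theorem euler_log_pi_log_two_series :
    (Real.eulerMascheroniConstant - Real.log Real.pi + Real.log 2 =
      ∑' n : ℕ, 2 * ((Nat.digits 2 (n + 1)).count 1 : ℝ) /
        (2 * (n + 1 : ℝ) * (2 * (n + 1 : ℝ) + 1) * (2 * (n + 1 : ℝ) + 2))) ∧
    ∀ n : ℕ, 0 ≤ 2 * ((Nat.digits 2 (n + 1)).count 1 : ℝ) /
        (2 * (n + 1 : ℝ) * (2 * (n + 1 : ℝ) + 1) * (2 * (n + 1 : ℝ) + 2)) := by
  refine ⟨?_, fun n ↦ by positivity⟩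
  have h := (hasSum_nat_add_iff' 1).2 hasSum_binaryOnes_mul
  rw [sum_range_one, binaryOnes_zero, Nat.cast_zero, zero_mul, sub_zero,
    Real.log_div Real.pi_ne_zero two_ne_zero, ← sub_add] at h
  rw [← h.tsum_eq]
  refine tsum_congr fun n ↦ ?_
  rw [binaryOnes]
  push_cast
  ring
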